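/- Strong duality holds for problem (P1): the supremum of g(λ, β) over all λ ∈ ℝ^K with λ_k ≥ 0 and β ≥ 0 equals the primal optimal value V of problem (P1), i.e. sup_{λ ≥ 0, β ≥ 0} g(λ, β) = V. -/

import Mathlib

/-- The multiplier form of Slater's theorem: a lower bound `V` of a convex objective `φ` over the
feasible set of finitely many convex constraints `h i ≤ 0` is a lower bound of some Lagrangian,
provided that a strictly feasible point exists. -/
theorem exists_multiplier_of_strictly_feasible {E ι : Type*} [AddCommGroup E] [Module ℝ E]
    [Fintype ι] {C : Set E} {h : ι → E → ℝ} {φ : E → ℝ} {V : ℝ}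
    (hh : ∀ i, ConvexOn ℝ C (h i)) (hφ : ConvexOn ℝ C φ)
    (hV : ∀ x ∈ C, (∀ i, h i x ≤ 0) → V ≤ φ x)
    (hS : ∃ x ∈ C, ∀ i, h i x < 0) :
    ∃ l : ι → ℝ, (∀ i, 0 ≤ l i) ∧ ∀ x ∈ C, V ≤ φ x + ∑ i, l i * h i x := by
  classical
  obtain ⟨x₀, hx₀, hx₀neg⟩ := hS
  let A : Set ((ι → ℝ) × ℝ) := {p | ∃ x ∈ C, (∀ i, h i x < p.1 i) ∧ φ x < p.2}
  have A_open : IsOpen A := by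
    have hA : A = ⋃ x ∈ C, ((⋂ i, {p | h i x < p.1 i}) ∩ {p | φ x < p.2}) := by
      ext p
      simp only [A, Set.mem_ofPred_eq, Set.mem_iUnion, Set.mem_inter_iff, Set.mem_iInter,
        exists_prop]
    rw [hA]
    refine isOpen_biUnion fun x _ => IsOpen.inter (isOpen_iInter_of_finite fun i => ?_) ?_
    · exact isOpen_lt continuous_const (by fun_prop)
    · exact isOpen_lt continuous_const (by fun_prop)
  have A_convex : Convex ℝ A := by
    rintro p ⟨x, hx, hxp, hxw⟩ q ⟨y, hy, hyq, hyw⟩ b c hb hc hbc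
    have combine : ∀ {u v u' v' : ℝ}, u < u' → v < v' → b * u + c * v < b * u' + c * v' := by
      intro u v u' v' hu hv
      rcases hb.eq_or_lt with rfl | hb'
      · obtain rfl : c = 1 := by linarith
        linarith
      · nlinarith [mul_lt_mul_of_pos_left hu hb', mul_le_mul_of_nonneg_left hv.le hc]
    refine ⟨b • x + c • y, hφ.1 hx hy hb hc hbc, fun i => ?_, ?_⟩
    · exact ((hh i).2 hx hy hb hc hbc).trans_lt (combine (hxp i) (hyq i))
    · exact (hφ.2 hx hy hb hc hbc).trans_lt (combine hxw hyw)
  have notMem : ((0 : ι → ℝ), V) ∉ A := by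
    rintro ⟨x, hx, hx0, hxV⟩
    exact absurd (hV x hx fun i => (hx0 i).le) (not_le.mpr hxV)
  obtain ⟨F, hF⟩ := geometric_hahn_banach_open_point A_convex A_open notMem
  let m : ι → ℝ := fun i => F (Pi.single i 1, 0)
  let γ : ℝ := F (0, 1)
  have F_apply : ∀ u w, F (u, w) = ∑ i, m i * u i + γ * w := by
    intro u w
    have huw : ((u, w) : (ι → ℝ) × ℝ)
        = ∑ i, u i • ((Pi.single i 1, 0) : (ι → ℝ) × ℝ) + w • ((0, 1) : (ι → ℝ) × ℝ) := by
      ext j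
      · simp [Prod.fst_sum, Finset.sum_apply, Pi.single_apply]
      · simp [Prod.snd_sum]
    simp only [huw, map_add, map_sum, map_smul, smul_eq_mul, m, γ, mul_comm]
  have separated : ∀ x ∈ C, ∀ (u : ι → ℝ) (w : ℝ), (∀ i, h i x < u i) → φ x < w →
      ∑ i, m i * u i + γ * w < γ * V := by
    intro x hx u w hu hw
    have hlt := hF (u, w) ⟨x, hx, hu, hw⟩
    rw [F_apply, F_apply] at hlt
    simpa using hlt
  have slope_nonpos : ∀ {d e r : ℝ}, (∀ c, 0 ≤ c → e + c * d < r) → d ≤ 0 := by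
    intro d e r hr
    by_contra! hd
    have h0 := hr 0 le_rfl
    have h1 := hr ((r - e) / d) (div_nonneg (by linarith) hd.le)
    rw [div_mul_cancel₀ _ hd.ne'] at h1
    linarith
  have m_nonpos : ∀ i, m i ≤ 0 := by
    intro i
    refine slope_nonpos (e := γ * (φ x₀ + 1)) (r := γ * V) fun c hc => ?_
    have := separated x₀ hx₀ (Pi.single i c) (φ x₀ + 1) (fun j => ?_) (by linarith)
    · simpa [Pi.single_apply, mul_comm, add_comm] using this
    · have hj : 0 ≤ (Pi.single i c : ι → ℝ) j := by
        rw [Pi.single_apply]; split_ifs <;> simp [hc]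
      exact (hx₀neg j).trans_le hj
  have γ_neg : γ < 0 := by
    have γ_nonpos : γ ≤ 0 := by
      refine slope_nonpos (e := γ * (φ x₀ + 1)) (r := γ * V) fun c hc => ?_
      have := separated x₀ hx₀ 0 (φ x₀ + 1 + c) hx₀neg (by linarith)
      simp only [Pi.zero_apply, mul_zero, Finset.sum_const_zero, zero_add] at this
      linarith
    refine lt_of_le_of_ne γ_nonpos fun h0 => ?_
    have := separated x₀ hx₀ 0 (φ x₀ + 1) hx₀neg (by linarith)
    simp [h0] at this
  refine ⟨fun i => m i / γ, fun i => div_nonneg_of_nonpos (m_nonpos i) γ_neg.le, fun x hx => ?_⟩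
  have limit : ∑ i, m i * h i x + γ * φ x ≤ γ * V := by
    have hle : ∀ ε > 0, ∑ i, m i * (h i x + ε) + γ * (φ x + ε) ≤ γ * V := fun ε hε =>
      (separated x hx (fun i => h i x + ε) (φ x + ε) (fun i => by linarith) (by linarith)).le
    have hcont : Continuous fun ε : ℝ => ∑ i, m i * (h i x + ε) + γ * (φ x + ε) := by fun_prop
    have hlim := (hcont.tendsto 0).mono_left (nhdsWithin_le_nhds (s := Set.Ioi 0))
    simp only [add_zero] at hlim
    exact le_of_tendsto hlim (Filter.eventually_of_mem self_mem_nhdsWithin hle)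
  have scaled : ∑ i, m i / γ * h i x = (∑ i, m i * h i x) / γ := by
    rw [Finset.sum_div]
    exact Finset.sum_congr rfl fun i _ => by ring
  have hdiv : V - φ x ≤ (∑ i, m i * h i x) / γ := by
    rw [le_div_iff_of_neg γ_neg]
    nlinarith
  rw [scaled]
  linarith

/-- The power cost `(s, t) ↦ t * (exp (a * s / t) - 1)` is the perspective of a convex function. -/
theorem perspective_exp_le (a : ℝ) {s₁ s₂ t₁ t₂ b c : ℝ} (ht₁ : 0 < t₁) (ht₂ : 0 < t₂)
    (hb : 0 ≤ b) (hc : 0 ≤ c) (hbc : b + c = 1) :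
    (b * t₁ + c * t₂) * (Real.exp (a * (b * s₁ + c * s₂) / (b * t₁ + c * t₂)) - 1)
      ≤ b * (t₁ * (Real.exp (a * s₁ / t₁) - 1)) + c * (t₂ * (Real.exp (a * s₂ / t₂) - 1)) := by
  have hT : 0 < b * t₁ + c * t₂ := by
    rcases hb.eq_or_lt with rfl | hb'
    · obtain rfl : c = 1 := by linarith
      linarith
    · have := mul_pos hb' ht₁
      have := mul_nonneg hc ht₂.le
      linarith
  set T := b * t₁ + c * t₂ with hTdef
  have key := convexOn_exp.2 (Set.mem_univ (a * s₁ / t₁)) (Set.mem_univ (a * s₂ / t₂))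
    (show 0 ≤ b * t₁ / T by positivity) (show 0 ≤ c * t₂ / T by positivity)
    (by rw [← add_div, ← hTdef, div_self hT.ne'])
  simp only [smul_eq_mul] at key
  have harg : b * t₁ / T * (a * s₁ / t₁) + c * t₂ / T * (a * s₂ / t₂)
      = a * (b * s₁ + c * s₂) / T := by
    field_simp
  rw [harg] at key
  have hmul := mul_le_mul_of_nonneg_left key hT.le
  have hrhs : T * (b * t₁ / T * Real.exp (a * s₁ / t₁) + c * t₂ / T * Real.exp (a * s₂ / t₂))
      = b * t₁ * Real.exp (a * s₁ / t₁) + c * t₂ * Real.exp (a * s₂ / t₂) := by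
    field_simp
  rw [hrhs] at hmul
  linarith

/-- The domain of the allocation variables `(s, t)`. -/
def allocationDomain (K N : ℕ) : Set ((Fin K → Fin N → ℝ) × (Fin K → ℝ)) :=
  {x | (∀ k n, 0 ≤ x.1 k n) ∧ ∀ k, 0 < x.2 k}

theorem convex_allocationDomain (K N : ℕ) : Convex ℝ (allocationDomain K N) := by
  rintro ⟨s, t⟩ ⟨hs, ht⟩ ⟨s', t'⟩ ⟨hs', ht'⟩ b c hb hc hbc
  refine ⟨fun k n => add_nonneg (mul_nonneg hb (hs k n)) (mul_nonneg hc (hs' k n)), fun k => ?_⟩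
  exact convex_Ioi (0 : ℝ) (ht k) (ht' k) hb hc hbc

theorem convexOn_power_excess {K N : ℕ} (a : ℝ) {f : Fin K → Fin N → ℝ}
    (hf : ∀ k n, 0 < f k n) (P : ℝ) :
    ConvexOn ℝ (allocationDomain K N) fun x =>
      (∑ k, ∑ n, x.2 k * (Real.exp (a * x.1 k n / x.2 k) - 1) / f k n) - P * ∑ k, x.2 k := by
  refine ⟨convex_allocationDomain K N, ?_⟩
  rintro ⟨s, t⟩ ⟨-, ht⟩ ⟨s', t'⟩ ⟨-, ht'⟩ b c hb hc hbc
  have hpow : ∑ k, ∑ n, (b * t k + c * t' k) *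
        (Real.exp (a * (b * s k n + c * s' k n) / (b * t k + c * t' k)) - 1) / f k n
      ≤ b * (∑ k, ∑ n, t k * (Real.exp (a * s k n / t k) - 1) / f k n)
        + c * ∑ k, ∑ n, t' k * (Real.exp (a * s' k n / t' k) - 1) / f k n := by
    simp only [Finset.mul_sum, ← Finset.sum_add_distrib]
    refine Finset.sum_le_sum fun k _ => Finset.sum_le_sum fun n _ => ?_
    rw [← mul_div_assoc, ← mul_div_assoc, ← add_div]
    exact div_le_div_of_nonneg_right (perspective_exp_le a (ht k) (ht' k) hb hc hbc) (hf k n).le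
  have hlin : ∑ k, (b * t k + c * t' k) = b * ∑ k, t k + c * ∑ k, t' k := by
    simp only [Finset.mul_sum, ← Finset.sum_add_distrib]
  simp only [Prod.smul_mk, Prod.mk_add_mk, Pi.add_apply, Pi.smul_apply, smul_eq_mul]
  rw [hlin]
  linarith

theorem convexOn_rate_deficit {K N : ℕ} (Q : Fin K → ℝ) (k : Fin K) :
    ConvexOn ℝ (allocationDomain K N) fun x => Q k - ∑ n, x.1 k n := by
  refine ⟨convex_allocationDomain K N, ?_⟩
  rintro ⟨s, t⟩ - ⟨s', t'⟩ - b c hb hc hbc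
  simp only [Prod.smul_mk, Prod.mk_add_mk, Pi.add_apply, Pi.smul_apply, smul_eq_mul,
    Finset.sum_add_distrib, ← Finset.mul_sum]
  obtain rfl : c = 1 - b := by linarith
  apply le_of_eq
  ring

theorem convexOn_energy {K N : ℕ} (w : Fin K → ℝ) :
    ConvexOn ℝ (allocationDomain K N) fun x => ∑ k, w k * x.2 k := by
  refine ⟨convex_allocationDomain K N, ?_⟩
  rintro ⟨s, t⟩ - ⟨s', t'⟩ - b c hb hc hbc
  simp only [Prod.smul_mk, Prod.mk_add_mk, Pi.add_apply, Pi.smul_apply, smul_eq_mul,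
    Finset.mul_sum, ← Finset.sum_add_distrib]
  exact le_of_eq (Finset.sum_congr rfl fun k _ => by ring)

/-- Long enough on-times make every rate requirement achievable with power to spare. -/
theorem exists_strictly_feasible_allocation {K N : ℕ} (hK : 0 < K) (hN : 0 < N) (a : ℝ)
    (f : Fin K → Fin N → ℝ) {Q : Fin K → ℝ} (hQ : ∀ k, 0 < Q k) {P : ℝ} (hP : 0 < P) :
    ∃ x ∈ allocationDomain K N, (∀ k, Q k < ∑ n, x.1 k n) ∧
      ∑ k, ∑ n, x.2 k * (Real.exp (a * x.1 k n / x.2 k) - 1) / f k n < P * ∑ k, x.2 k := by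
  have hlim : Filter.Tendsto
      (fun T : ℝ => ∑ k, ∑ n : Fin N, (Real.exp (a * (Q k + 1) / T) - 1) / f k n)
      Filter.atTop (nhds (∑ k, ∑ n : Fin N, (Real.exp 0 - 1) / f k n)) := by
    refine tendsto_finsetSum _ fun k _ => tendsto_finsetSum _ fun n _ => ?_
    refine Filter.Tendsto.div_const (Filter.Tendsto.sub_const ?_ 1) _
    exact (Real.continuous_exp.tendsto 0).comp (tendsto_const_nhds.div_atTop Filter.tendsto_id)
  simp only [Real.exp_zero, sub_self, zero_div, Finset.sum_const_zero] at hlim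
  have hPK : 0 < P * K := by positivity
  obtain ⟨T, hTlt, hT⟩ := ((hlim.eventually (gt_mem_nhds hPK)).and
    (Filter.eventually_gt_atTop 0)).exists
  refine ⟨(fun k _ => Q k + 1, fun _ => T), ⟨fun k _ => by linarith [hQ k], fun _ => hT⟩,
    fun k => ?_, ?_⟩
  · have hN1 : (1 : ℝ) ≤ N := by exact_mod_cast hN
    simp only [Finset.sum_const, Finset.card_univ, Fintype.card_fin, nsmul_eq_mul]
    nlinarith [hQ k]
  · have hmul := mul_lt_mul_of_pos_left hTlt hT
    simp only [Finset.mul_sum, ← mul_div_assoc] at hmul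
    simp only [Finset.sum_const, Finset.card_univ, Fintype.card_fin, nsmul_eq_mul] at hmul ⊢
    linarith

/-- Strong duality holds for problem (P1): the supremum of the
dual function g(λ, β) over λ ≥ 0, β ≥ 0 equals the primal optimal value V. -/
theorem p1_strong_duality
    (K N : ℕ) (hK : 0 < K) (hN : 0 < N)
    (a : ℝ) (ha : 0 < a)
    (f : Fin K → Fin N → ℝ) (hf : ∀ k n, 0 < f k n)
    (Q : Fin K → ℝ) (hQ : ∀ k, 0 < Q k)
    (Pavg : ℝ) (hPavg : 0 < Pavg)
    (Prc : ℝ) (hPrc : 0 < Prc)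
    (α : Fin K → ℝ) (hα : ∀ k, 0 < α k)
    (g : (Fin K → ℝ) → ℝ → ℝ)
    (hg : ∀ (lam : Fin K → ℝ) (β : ℝ),
      g lam β = sInf {y : ℝ | ∃ (s : Fin K → Fin N → ℝ) (t : Fin K → ℝ),
        (∀ k n, 0 ≤ s k n) ∧ (∀ k, 0 < t k) ∧
        y = (∑ k, α k * Prc * t k)
            - (∑ k, lam k * ((∑ n, s k n) - Q k))
            + β * ((∑ k, ∑ n, t k * (Real.exp (a * s k n / t k) - 1) / f k n)
                - Pavg * ∑ k, t k)})
    (V : ℝ)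
    (hV : V = sInf {E : ℝ | ∃ (s : Fin K → Fin N → ℝ) (t : Fin K → ℝ),
        (∀ k n, 0 ≤ s k n) ∧ (∀ k, 0 < t k) ∧
        (∀ k, Q k ≤ ∑ n, s k n) ∧
        (∑ k, ∑ n, t k * (Real.exp (a * s k n / t k) - 1) / f k n
          ≤ Pavg * ∑ k, t k) ∧
        E = ∑ k, α k * Prc * t k}) :
    sSup {y : ℝ | ∃ (lam : Fin K → ℝ) (β : ℝ),
        (∀ k, 0 ≤ lam k) ∧ 0 ≤ β ∧ y = g lam β} = V := by
  obtain ⟨⟨s₀, t₀⟩, ⟨hs₀, ht₀⟩, hrate₀, hpow₀⟩ :=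
    exists_strictly_feasible_allocation hK hN a f hQ hPavg
  set primal := {E : ℝ | ∃ (s : Fin K → Fin N → ℝ) (t : Fin K → ℝ),
        (∀ k n, 0 ≤ s k n) ∧ (∀ k, 0 < t k) ∧
        (∀ k, Q k ≤ ∑ n, s k n) ∧
        (∑ k, ∑ n, t k * (Real.exp (a * s k n / t k) - 1) / f k n
          ≤ Pavg * ∑ k, t k) ∧
        E = ∑ k, α k * Prc * t k}
  have primal_nonneg : ∀ E ∈ primal, 0 ≤ E := by
    rintro E ⟨s, t, -, ht, -, -, rfl⟩
    exact Finset.sum_nonneg fun k _ => (mul_pos (mul_pos (hα k) hPrc) (ht k)).le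
  have primal_nonempty : primal.Nonempty :=
    ⟨_, s₀, t₀, hs₀, ht₀, fun k => (hrate₀ k).le, hpow₀.le, rfl⟩
  have V_nonneg : 0 ≤ V := hV ▸ Real.sInf_nonneg primal_nonneg
  have weak : ∀ (lam : Fin K → ℝ) (β : ℝ), (∀ k, 0 ≤ lam k) → 0 ≤ β → g lam β ≤ V := by
    intro lam β hlam hβ
    rw [hg]
    by_cases hbdd : BddBelow {y : ℝ | ∃ (s : Fin K → Fin N → ℝ) (t : Fin K → ℝ),
        (∀ k n, 0 ≤ s k n) ∧ (∀ k, 0 < t k) ∧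
        y = (∑ k, α k * Prc * t k)
            - (∑ k, lam k * ((∑ n, s k n) - Q k))
            + β * ((∑ k, ∑ n, t k * (Real.exp (a * s k n / t k) - 1) / f k n)
                - Pavg * ∑ k, t k)}
    · rw [hV]
      refine le_csInf primal_nonempty ?_
      rintro E ⟨s, t, hs, ht, hrate, hpow, rfl⟩
      refine (csInf_le hbdd ⟨s, t, hs, ht, rfl⟩).trans ?_
      have h1 : 0 ≤ ∑ k, lam k * ((∑ n, s k n) - Q k) :=
        Finset.sum_nonneg fun k _ => mul_nonneg (hlam k) (sub_nonneg.mpr (hrate k))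
      have h2 := mul_nonpos_of_nonneg_of_nonpos hβ (sub_nonpos.mpr hpow)
      linarith
    · rwa [Real.sInf_of_not_bddBelow hbdd]
  obtain ⟨l, hl, hlag⟩ := exists_multiplier_of_strictly_feasible (V := V)
    (h := fun i : Option (Fin K) => i.elim
      (fun x : (Fin K → Fin N → ℝ) × (Fin K → ℝ) =>
        (∑ k, ∑ n, x.2 k * (Real.exp (a * x.1 k n / x.2 k) - 1) / f k n) - Pavg * ∑ k, x.2 k)
      (fun k x => Q k - ∑ n, x.1 k n))
    (Option.forall.mpr ⟨convexOn_power_excess a hf Pavg, convexOn_rate_deficit Q⟩)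
    (convexOn_energy fun k => α k * Prc)
    (by
      rintro ⟨s, t⟩ ⟨hs, ht⟩ hfeas
      rw [hV]
      exact csInf_le ⟨0, primal_nonneg⟩ ⟨s, t, hs, ht,
        fun k => sub_nonpos.mp (hfeas (some k)), sub_nonpos.mp (hfeas none), rfl⟩)
    ⟨(s₀, t₀), ⟨hs₀, ht₀⟩, Option.forall.mpr
      ⟨sub_neg.mpr hpow₀, fun k => sub_neg.mpr (hrate₀ k)⟩⟩
  have attained : V ≤ g (fun k => l (some k)) (l none) := by
    rw [hg]
    refine le_csInf ⟨_, s₀, t₀, hs₀, ht₀, rfl⟩ ?_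
    rintro y ⟨s, t, hs, ht, rfl⟩
    have hst := hlag (s, t) ⟨hs, ht⟩
    rw [Fintype.sum_option] at hst
    have hneg : ∑ k, l (some k) * (Q k - ∑ n, s k n)
        = -∑ k, l (some k) * ((∑ n, s k n) - Q k) := by
      rw [← Finset.sum_neg_distrib]
      exact Finset.sum_congr rfl fun k _ => by ring
    simp only [Option.elim] at hst
    rw [hneg] at hst
    linarith
  refine IsGreatest.csSup_eq ⟨⟨fun k => l (some k), l none, fun k => hl _, hl _, ?_⟩, ?_⟩
  · exact attained.antisymm (weak _ _ (fun k => hl _) (hl _))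
  · rintro y ⟨lam, β, hlam, hβ, rfl⟩
    exact weak lam β hlam hβ
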